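/- arXiv:2501.11473 — 2 statements merged into one kernel-verified Lean document; each statement's English description precedes it below -/
import Mathlib

section
/- Let α > 1 and let P, Q be probability distributions on a finite set 𝒳 with P absolutely continuous with respect to Q (P(x) > 0 implies Q(x) > 0). Then D_{f_α}(P ‖ Q) ≥ exp( 2(α−1) · TV(P ‖ Q)² ) − 1. -/
open Real

lemma aux_deriv (t : ℝ) (ht : 0 < t) :
    HasDerivAt (fun t : ℝ => Real.log t - (5*t^2-4*t-1)/(2*t^2+4*t))
      ((t-1)^3/(t^2*(t+2)^2)) t := by
  have h1 : HasDerivAt (fun t : ℝ => 5*t^2-4*t-1) (10*t-4) t := by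
    have := (((hasDerivAt_pow 2 t).const_mul 5).sub ((hasDerivAt_id t).const_mul 4)).sub_const 1
    refine HasDerivAt.congr_deriv this ?_
    norm_num; ring
  have h2 : HasDerivAt (fun t : ℝ => 2*t^2+4*t) (4*t+4) t := by
    have := (((hasDerivAt_pow 2 t).const_mul 2).add ((hasDerivAt_id t).const_mul 4))
    refine HasDerivAt.congr_deriv this ?_
    norm_num; ring
  have h0 : 2*t^2+4*t ≠ 0 := by positivity
  refine ((Real.hasDerivAt_log ht.ne').sub (h1.div h2 h0)).congr_deriv ?_
  have e : 2*t^2+4*t = 2*(t*(t+2)) := by ring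
  have h3 : t + 2 ≠ 0 := by positivity
  rw [e]
  field_simp
  ring

lemma aux_log (t : ℝ) (ht : 0 < t) : (5*t^2-4*t-1)/(2*t^2+4*t) ≤ Real.log t := by
  have hc : ∀ s : Set ℝ, (∀ x ∈ s, 0 < x) →
      ContinuousOn (fun t : ℝ => Real.log t - (5*t^2-4*t-1)/(2*t^2+4*t)) s :=
    fun s hs x hx => (aux_deriv x (hs x hx)).continuousAt.continuousWithinAt
  rcases le_total 1 t with h | h
  · have hm : MonotoneOn (fun t : ℝ => Real.log t - (5*t^2-4*t-1)/(2*t^2+4*t)) (Set.Icc 1 t) := by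
      apply monotoneOn_of_deriv_nonneg (convex_Icc 1 t)
      · exact hc _ fun x hx => by linarith [hx.1]
      · intro x hx
        rw [interior_Icc] at hx
        exact (aux_deriv x (by linarith [hx.1])).differentiableAt.differentiableWithinAt
      · intro x hx
        rw [interior_Icc] at hx
        rw [(aux_deriv x (by linarith [hx.1])).deriv]
        have : 0 ≤ x - 1 := by linarith [hx.1]
        positivity
    have := hm (Set.left_mem_Icc.2 h) (Set.right_mem_Icc.2 h) h
    norm_num at this
    linarith
  · have hm : AntitoneOn (fun t : ℝ => Real.log t - (5*t^2-4*t-1)/(2*t^2+4*t)) (Set.Icc t 1) := by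
      apply antitoneOn_of_deriv_nonpos (convex_Icc t 1)
      · exact hc _ fun x hx => by linarith [hx.1]
      · intro x hx
        rw [interior_Icc] at hx
        exact (aux_deriv x (by linarith [hx.1])).differentiableAt.differentiableWithinAt
      · intro x hx
        rw [interior_Icc] at hx
        rw [(aux_deriv x (by linarith [hx.1])).deriv]
        have : 0 ≤ 1 - x := by linarith [hx.2]
        have h3 : 0 ≤ (1-x)^3/(x^2*(x+2)^2) := by positivity
        have h4 : (x-1)^3/(x^2*(x+2)^2) = -((1-x)^3/(x^2*(x+2)^2)) := by ring
        linarith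
    have := hm (Set.left_mem_Icc.2 h) (Set.right_mem_Icc.2 h) h
    norm_num at this
    linarith

lemma aux_pt (p q : ℝ) (hp : 0 ≤ p) (hq : 0 ≤ q) (h : 0 < p → 0 < q) :
    3 / 2 * ((p-q)^2/(p+2*q)) ≤ p * Real.log (p/q) - p + q := by
  rcases hp.eq_or_lt with rfl | hp
  · rcases hq.eq_or_lt with rfl | hq
    · simp
    · have : (0-q)^2/(0+2*q) = q/2 := by field_simp; ring
      rw [this]; simp; linarith
  · have hq := h hp
    have := mul_le_mul_of_nonneg_left (aux_log (p/q) (by positivity)) hp.le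
    have e : p * ((5*(p/q)^2-4*(p/q)-1)/(2*(p/q)^2+4*(p/q)))
        = 3 / 2 * ((p-q)^2/(p+2*q)) + p - q := by
      have e1 : 2*(p/q)^2+4*(p/q) = 2*p*(p+2*q)/q^2 := by field_simp; ring
      have : p + 2*q ≠ 0 := by positivity
      rw [e1]
      field_simp
      ring
    linarith

lemma aux_pinsker {X : Type*} [Fintype X]
    (P Q : X → ℝ) (hP0 : ∀ x, 0 ≤ P x) (hQ0 : ∀ x, 0 ≤ Q x)
    (hP1 : ∑ x, P x = 1) (hQ1 : ∑ x, Q x = 1)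
    (hac : ∀ x, 0 < P x → 0 < Q x) :
    2 * ((1 / 2) * ∑ x, |P x - Q x|) ^ 2 ≤ ∑ x, P x * Real.log (P x / Q x) := by
  have h1 := Finset.sum_le_sum (s := Finset.univ)
    fun x _ => aux_pt (P x) (Q x) (hP0 x) (hQ0 x) (hac x)
  rw [← Finset.mul_sum, Finset.sum_add_distrib, Finset.sum_sub_distrib, hP1, hQ1] at h1
  have h2 := Finset.sum_sq_le_sum_mul_sum_of_sq_le_mul Finset.univ
    (r := fun x => |P x - Q x|) (f := fun x => (P x - Q x)^2/(P x + 2 * Q x))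
    (g := fun x => P x + 2 * Q x)
    (fun x _ => by have := hP0 x; have := hQ0 x; positivity)
    (fun x _ => by have := hP0 x; have := hQ0 x; positivity)
    (fun x _ => by
      have a := hP0 x
      have b := hQ0 x
      rw [sq_abs]
      by_cases h : P x + 2 * Q x = 0
      · have h3 : P x = 0 := by linarith
        have h4 : Q x = 0 := by linarith
        simp [h3, h4]
      · exact (div_mul_cancel₀ _ h).ge)
  rw [Finset.sum_add_distrib, ← Finset.mul_sum, hP1, hQ1] at h2
  nlinarith

/-- For `α > 1` and `P` absolutely continuous w.r.t. `Q` on a finite set,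
`D_{f_α}(P‖Q) ≥ exp(2(α−1) TV(P‖Q)²) − 1`. -/
theorem stmt_12 {X : Type*} [Fintype X] (α : ℝ) (hα : 1 < α)
    (P Q : X → ℝ) (hP0 : ∀ x, 0 ≤ P x) (hQ0 : ∀ x, 0 ≤ Q x)
    (hP1 : ∑ x, P x = 1) (hQ1 : ∑ x, Q x = 1)
    (hac : ∀ x, 0 < P x → 0 < Q x) :
    Real.exp (2 * (α - 1) * ((1 / 2) * ∑ x, |P x - Q x|) ^ 2) - 1 ≤
      (∑ x ∈ Finset.univ.filter (fun x => 0 < Q x), Q x * (P x / Q x) ^ α) - 1 := by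
  have hpin := aux_pinsker P Q hP0 hQ0 hP1 hQ1 hac
  have hK : 2 * (α - 1) * ((1 / 2) * ∑ x, |P x - Q x|) ^ 2 ≤
      (α - 1) * ∑ x, P x * Real.log (P x / Q x) := by
    have := mul_le_mul_of_nonneg_left hpin (sub_nonneg.2 hα.le)
    linarith
  generalize 2 * (α - 1) * ((1 / 2) * ∑ x, |P x - Q x|) ^ 2 = K at hK ⊢
  have hf : ∑ x ∈ Finset.univ.filter (fun x => 0 < Q x), Q x * (P x / Q x) ^ α
      = ∑ x, Q x * (P x / Q x) ^ α := by
    apply Finset.sum_filter_of_ne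
    intro x _ hx
    exact (hQ0 x).lt_of_ne fun h => hx (by simp [← h])
  rw [hf]
  have hpt : ∀ x, Real.exp K * ((1 - K) * P x + (α - 1) * (P x * Real.log (P x / Q x)))
      ≤ Q x * (P x / Q x) ^ α := by
    intro x
    rcases (hP0 x).eq_or_lt with h | hp
    · rw [← h]
      simp [Real.zero_rpow (by linarith : α ≠ 0)]
    · have hq := hac x hp
      have hr : 0 < P x / Q x := by positivity
      have e : Q x * (P x / Q x) ^ α
          = P x * (Real.exp K * Real.exp ((α - 1) * Real.log (P x / Q x) - K)) := by
        rw [← Real.exp_add, show K + ((α - 1) * Real.log (P x / Q x) - K)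
          = Real.log (P x / Q x) * (α - 1) by ring, ← Real.rpow_def_of_pos hr,
          Real.rpow_sub_one hr.ne']
        field_simp
      rw [e]
      have := Real.add_one_le_exp ((α - 1) * Real.log (P x / Q x) - K)
      have := mul_le_mul_of_nonneg_left this (mul_pos hp (Real.exp_pos K)).le
      linarith
  have hs := Finset.sum_le_sum (s := Finset.univ) fun x _ => hpt x
  rw [← Finset.mul_sum, Finset.sum_add_distrib, ← Finset.mul_sum, ← Finset.mul_sum, hP1] at hs
  have := Real.exp_pos K
  nlinarith
end

section
/- Let α > 1, let 𝒳, 𝒴 be finite sets, let K be a channel from 𝒳 to 𝒴, and let P, Q be probability distributions on 𝒳 with P(x) > 0 iff Q(x) > 0, such that K∘P and K∘Q are strictly positive and K∘P ≠ K∘Q. Suppose η ≥ 0 satisfies TV(K∘P ‖ K∘Q) ≤ η · TV(P ‖ Q). Set u = max_y (K∘P)(y)/(K∘Q)(y) and v = min_y (K∘P)(y)/(K∘Q)(y). Then D_{f_α}(K∘P ‖ K∘Q) ≤ η · R_α(u, v) · g_α^{-1}( D_{f_α}(P ‖ Q) ), where R_α(u, v) = (u^α − 1)/(u − 1) − (1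 − v^α)/(1 − v), and g_α^{-1} is defined by: g_α^{-1}(s) = sqrt( log(s+1)/(2(α−1)) ) if α < 2 and s < 2 − 2/α; g_α^{-1}(s) = (1/2) sqrt( (s+1)^{1/(α−1)} − 1 ) if α ≥ 2 and s < (1 + 4/α²)^{α−1} − 1; and g_α^{-1}(s) = max{ 1 − (s+1)^{1/(1−α)}, 1/α } otherwise. -/
open Real

theorem aux_tv {ι : Type*} (F : Finset ι) (P Q : ι → ℝ)
    (hP1 : ∑ x ∈ F, P x = 1) (hQ1 : ∑ x ∈ F, Q x = 1) :
    (1/2) * ∑ x ∈ F, |P x - Q x| =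
      ∑ x ∈ F with Q x < P x, P x - ∑ x ∈ F with Q x < P x, Q x := by
  have h : ∑ x ∈ F, |P x - Q x| + ∑ x ∈ F, (P x - Q x)
      = 2 * ∑ x ∈ F with Q x < P x, (P x - Q x) := by
    rw [← Finset.sum_add_distrib, Finset.mul_sum, Finset.sum_filter]
    refine Finset.sum_congr rfl fun x _ => ?_
    split_ifs with h
    · rw [abs_of_pos (by linarith)]; ring
    · rw [abs_of_nonpos (by linarith)]; ring
  rw [Finset.sum_sub_distrib, Finset.sum_sub_distrib] at h
  linarith

theorem aux_bin {p q : ℝ} (hq : 0 < q) (hqp : q ≤ p) (hp : p < 1) :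
    2 * (p - q) ^ 2 ≤ p * log (p / q) + (1 - p) * log ((1 - p) / (1 - q)) := by
  have key : AntitoneOn (fun x => -p * log x - (1 - p) * log (1 - x) - 2 * (p - x) ^ 2)
      (Set.Icc q p) := by
    have hd : ∀ x ∈ Set.Icc q p, HasDerivAt
        (fun x => -p * log x - (1 - p) * log (1 - x) - 2 * (p - x) ^ 2)
        (-p * x⁻¹ - (1 - p) * (-1 / (1 - x)) - 2 * ((2 : ℕ) * (p - x) ^ (2 - 1) * (-1))) x := by
      intro x hx
      have hx0 : x ≠ 0 := by linarith [hx.1]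
      have hx1 : 1 - x ≠ 0 := by linarith [hx.2]
      exact (((Real.hasDerivAt_log hx0).const_mul _).sub
        ((((hasDerivAt_id x).const_sub 1).log hx1).const_mul _)).sub
        ((((hasDerivAt_id x).const_sub p).pow 2).const_mul _)
    apply antitoneOn_of_deriv_nonpos (convex_Icc _ _)
    · exact fun x hx => (hd x hx).continuousAt.continuousWithinAt
    · exact fun x hx => (hd x (interior_subset hx)).differentiableAt.differentiableWithinAt
    · intro x hx
      have hx := interior_subset hx
      rw [(hd x hx).deriv]
      have hx0 : 0 < x := by linarith [hx.1]
      have hx1 : 0 < 1 - x := by linarith [hx.2]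
      have e : -p * x⁻¹ - (1 - p) * (-1 / (1 - x)) - 2 * ((2 : ℕ) * (p - x) ^ (2 - 1) * (-1))
        = -((p - x) * (1 - 2 * x) ^ 2 / (x * (1 - x))) := by
        field_simp; push_cast; ring
      rw [e]
      have : 0 ≤ p - x := by linarith [hx.2]
      have : 0 ≤ (p - x) * (1 - 2 * x) ^ 2 / (x * (1 - x)) := by positivity
      linarith
  have := key (Set.left_mem_Icc.2 hqp) (Set.right_mem_Icc.2 hqp) hqp
  simp only at this
  rw [log_div (by linarith) (by linarith), log_div (by linarith) (by linarith)]
  nlinarith [this]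

theorem aux_logsum {ι : Type*} (A : Finset ι) (P Q : ι → ℝ) (hP : ∀ x ∈ A, 0 < P x)
    (hQ : ∀ x ∈ A, 0 < Q x) (hp : 0 < ∑ x ∈ A, P x) (hq : 0 < ∑ x ∈ A, Q x) :
    (∑ x ∈ A, P x) * log ((∑ x ∈ A, P x) / ∑ x ∈ A, Q x) ≤ ∑ x ∈ A, P x * log (P x / Q x) := by
  set p := ∑ x ∈ A, P x with hpd
  set q := ∑ x ∈ A, Q x with hqd
  have : ∑ x ∈ A, (P x * log (p / q) + P x - Q x * (p / q)) ≤ ∑ x ∈ A, P x * log (P x / Q x) := by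
    refine Finset.sum_le_sum fun x hx => ?_
    have h1 := hP x hx
    have h2 := hQ x hx
    have h := log_le_sub_one_of_pos (x := (p / q) / (P x / Q x)) (by positivity)
    rw [log_div (by positivity) (by positivity)] at h
    have h3 := mul_le_mul_of_nonneg_left h h1.le
    have e : P x * (p / q / (P x / Q x) - 1) = Q x * (p / q) - P x := by field_simp
    rw [e] at h3
    linarith
  rw [Finset.sum_sub_distrib, Finset.sum_add_distrib, ← Finset.sum_mul, ← Finset.sum_mul,
    ← hpd, ← hqd] at this
  have e : q * (p / q) = p := by field_simp
  linarith

theorem aux_pinsker_s14 {ι : Type*} (F : Finset ι) (P Q : ι → ℝ) (hP : ∀ x ∈ F, 0 < P x)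
    (hQ : ∀ x ∈ F, 0 < Q x) (hP1 : ∑ x ∈ F, P x = 1) (hQ1 : ∑ x ∈ F, Q x = 1) :
    2 * ((1/2) * ∑ x ∈ F, |P x - Q x|) ^ 2 ≤ ∑ x ∈ F, P x * log (P x / Q x) := by
  have hl := aux_logsum F P Q hP hQ (by linarith) (by linarith)
  rw [hP1, hQ1] at hl
  norm_num at hl
  rw [aux_tv F P Q hP1 hQ1]
  have hPs := Finset.sum_filter_add_sum_filter_not F (fun x => Q x < P x) P
  have hQs := Finset.sum_filter_add_sum_filter_not F (fun x => Q x < P x) Q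
  have hKs := Finset.sum_filter_add_sum_filter_not F (fun x => Q x < P x)
    (fun x => P x * log (P x / Q x))
  have hfP : ∀ x ∈ F.filter (fun x => Q x < P x), 0 < P x :=
    fun x hx => hP x (Finset.mem_filter.1 hx).1
  have hfQ : ∀ x ∈ F.filter (fun x => Q x < P x), 0 < Q x :=
    fun x hx => hQ x (Finset.mem_filter.1 hx).1
  have hfP' : ∀ x ∈ F.filter (fun x => ¬ Q x < P x), 0 < P x :=
    fun x hx => hP x (Finset.mem_filter.1 hx).1
  have hfQ' : ∀ x ∈ F.filter (fun x => ¬ Q x < P x), 0 < Q x :=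
    fun x hx => hQ x (Finset.mem_filter.1 hx).1
  have hle : ∑ x ∈ F with Q x < P x, Q x ≤ ∑ x ∈ F with Q x < P x, P x :=
    Finset.sum_le_sum fun x hx => (Finset.mem_filter.1 hx).2.le
  rcases (F.filter (fun x => Q x < P x)).eq_empty_or_nonempty with hA | hA
  · rw [hA]; simpa using hl
  rcases (F.filter (fun x => ¬ Q x < P x)).eq_empty_or_nonempty with hB | hB
  · rw [hB] at hPs hQs
    rw [Finset.sum_empty, add_zero] at hPs hQs
    rw [hPs, hQs, hP1, hQ1]; simpa using hl
  have a1 := Finset.sum_pos hfP hA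
  have a2 := Finset.sum_pos hfQ hA
  have a3 := Finset.sum_pos hfP' hB
  have a4 := Finset.sum_pos hfQ' hB
  have l1 := aux_logsum _ P Q hfP hfQ a1 a2
  have l2 := aux_logsum _ P Q hfP' hfQ' a3 a4
  have b := aux_bin a2 hle (by linarith)
  rw [show 1 - ∑ x ∈ F with Q x < P x, P x = ∑ x ∈ F with ¬ Q x < P x, P x by linarith,
    show 1 - ∑ x ∈ F with Q x < P x, Q x = ∑ x ∈ F with ¬ Q x < P x, Q x by linarith] at b
  linarith

theorem aux_S {ι : Type*} (F : Finset ι) (P Q : ι → ℝ) (α : ℝ) (hP : ∀ x ∈ F, 0 < P x)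
    (hQ : ∀ x ∈ F, 0 < Q x) :
    ∑ x ∈ F, Q x * (P x / Q x) ^ α = ∑ x ∈ F, P x * (P x / Q x) ^ (α - 1) := by
  refine Finset.sum_congr rfl fun x hx => ?_
  have h1 := hP x hx
  have h2 := hQ x hx
  rw [rpow_sub_one (by positivity)]
  field_simp

theorem aux_reg1 {ι : Type*} (F : Finset ι) (P Q : ι → ℝ) (α : ℝ) (hα : 1 < α)
    (hP : ∀ x ∈ F, 0 < P x)
    (hQ : ∀ x ∈ F, 0 < Q x) (hP1 : ∑ x ∈ F, P x = 1) (hQ1 : ∑ x ∈ F, Q x = 1) :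
    (1/2) * ∑ x ∈ F, |P x - Q x| ≤
      √(log (∑ x ∈ F, Q x * (P x / Q x) ^ α) / (2 * (α - 1))) := by
  apply Real.le_sqrt_of_sq_le
  have hpin := aux_pinsker_s14 F P Q hP hQ hP1 hQ1
  rw [aux_S F P Q α hP hQ]
  set S := ∑ x ∈ F, P x * (P x / Q x) ^ (α - 1) with hS
  have hne : F.Nonempty := by
    by_contra h
    rw [Finset.not_nonempty_iff_eq_empty] at h
    simp [h] at hP1
  have hSpos : 0 < S := Finset.sum_pos (fun x hx => by
    have := hP x hx; have := hQ x hx; positivity) hne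
  have : ∑ x ∈ F, ((α - 1) * (P x * log (P x / Q x)) - P x * log S) ≤
      ∑ x ∈ F, (P x * (P x / Q x) ^ (α - 1) / S - P x) := by
    refine Finset.sum_le_sum fun x hx => ?_
    have h1 := hP x hx
    have h2 := hQ x hx
    have h := log_le_sub_one_of_pos (x := (P x / Q x) ^ (α - 1) / S) (by positivity)
    rw [log_div (by positivity) (by positivity), log_rpow (by positivity)] at h
    have h3 := mul_le_mul_of_nonneg_left h h1.le
    have e : P x * ((P x / Q x) ^ (α - 1) / S - 1) = P x * (P x / Q x) ^ (α - 1) / S - P x := by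
      ring
    linarith
  rw [Finset.sum_sub_distrib, Finset.sum_sub_distrib, ← Finset.sum_div, ← hS,
    ← Finset.mul_sum, ← Finset.sum_mul, hP1, div_self hSpos.ne'] at this
  rw [le_div_iff₀ (by linarith)]
  nlinarith

theorem aux_reg2 {ι : Type*} (F : Finset ι) (P Q : ι → ℝ) (α : ℝ) (hα : 2 ≤ α)
    (hP : ∀ x ∈ F, 0 < P x)
    (hQ : ∀ x ∈ F, 0 < Q x) (hP1 : ∑ x ∈ F, P x = 1) (hQ1 : ∑ x ∈ F, Q x = 1) :
    (1/2) * ∑ x ∈ F, |P x - Q x| ≤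
      (1/2) * √((∑ x ∈ F, Q x * (P x / Q x) ^ α) ^ (1 / (α - 1)) - 1) := by
  apply mul_le_mul_of_nonneg_left _ (by norm_num)
  apply Real.le_sqrt_of_sq_le
  rw [aux_S F P Q α hP hQ]
  have hr : ∀ x ∈ F, 0 ≤ P x / Q x := fun x hx => (div_pos (hP x hx) (hQ x hx)).le
  have h1 := Real.rpow_arith_mean_le_arith_mean_rpow F P (fun x => P x / Q x)
    (fun x hx => (hP x hx).le) hP1 hr (p := α - 1) (by linarith)
  have hC : 0 ≤ ∑ x ∈ F, P x * (P x / Q x) :=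
    Finset.sum_nonneg fun x hx => mul_nonneg (hP x hx).le (hr x hx)
  have h2 := Real.rpow_le_rpow (by positivity) h1 (z := 1 / (α - 1))
    (by apply one_div_nonneg.2; linarith)
  rw [← Real.rpow_mul hC, mul_one_div_cancel (by linarith), rpow_one] at h2
  have h3 := Finset.sq_sum_div_le_sum_sq_div F (fun x => |P x - Q x|) hQ
  rw [hQ1, div_one] at h3
  have h4 : ∑ x ∈ F, |P x - Q x| ^ 2 / Q x
      = ∑ x ∈ F, (P x * (P x / Q x) - 2 * P x + Q x) := by
    refine Finset.sum_congr rfl fun x hx => ?_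
    have := hQ x hx
    rw [sq_abs]; field_simp; ring
  rw [Finset.sum_add_distrib, Finset.sum_sub_distrib, ← Finset.mul_sum, hP1, hQ1] at h4
  linarith

theorem aux_tangent {α a r : ℝ} (hα : 1 < α) (ha : 0 < a) (hr : 0 ≤ r) :
    α * a ^ (α - 1) * r - (α - 1) * a ^ α ≤ r ^ α := by
  have h := one_add_mul_self_le_rpow_one_add (s := r / a - 1) (by
    have : 0 ≤ r / a := by positivity
    linarith) hα.le
  rw [show 1 + (r / a - 1) = r / a by ring, div_rpow hr ha.le, le_div_iff₀ (by positivity)] at h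
  rw [rpow_sub_one ha.ne']
  have e : α * (a ^ α / a) * r - (α - 1) * a ^ α = (1 + α * (r / a - 1)) * a ^ α := by
    field_simp; ring
  linarith

theorem aux_reg3 {ι : Type*} (F : Finset ι) (P Q : ι → ℝ) (α : ℝ) (hα : 1 < α)
    (hP : ∀ x ∈ F, 0 < P x)
    (hQ : ∀ x ∈ F, 0 < Q x) (hP1 : ∑ x ∈ F, P x = 1) (hQ1 : ∑ x ∈ F, Q x = 1) :
    (1/2) * ∑ x ∈ F, |P x - Q x| ≤
      max (1 - (∑ x ∈ F, Q x * (P x / Q x) ^ α) ^ (1 / (1 - α))) (1 / α) := by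
  rw [aux_tv F P Q hP1 hQ1]
  set A := F.filter (fun x => Q x < P x) with hA
  set p := ∑ x ∈ A, P x with hp
  set q := ∑ x ∈ A, Q x with hq
  set S := ∑ x ∈ F, Q x * (P x / Q x) ^ α with hS
  rcases le_or_gt (p - q) (1 / α) with h | h
  · exact le_max_of_le_right h
  apply le_max_of_le_left
  have hsub : A ⊆ F := Finset.filter_subset _ _
  have hp1 : p ≤ 1 := by
    rw [← hP1]
    exact Finset.sum_le_sum_of_subset_of_nonneg hsub fun x hx _ => (hP x hx).le
  have hαpos : 0 < α := by linarith
  have hpq : 0 < p - q := lt_trans (by positivity) h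
  have hAne : A.Nonempty := by
    by_contra h'
    rw [Finset.not_nonempty_iff_eq_empty] at h'
    simp [hp, hq, h'] at hpq
  have hqpos : 0 < q := Finset.sum_pos (fun x hx => hQ x (hsub hx)) hAne
  have ht1 : 0 < 1 - (p - q) := by linarith
  obtain ⟨a, ha⟩ : ∃ a, a = (1 - (p - q))⁻¹ := ⟨_, rfl⟩
  have hapos : 0 < a := by rw [ha]; positivity
  have hat : a * (1 - (p - q)) = 1 := by rw [ha]; field_simp
  have hSA : ∑ x ∈ A, Q x * (P x / Q x) ^ α ≤ S :=
    Finset.sum_le_sum_of_subset_of_nonneg hsub fun x hx _ => by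
      have := hP x hx; have := hQ x hx; positivity
  have hT : ∑ x ∈ A, (α * a ^ (α - 1) * P x - (α - 1) * a ^ α * Q x) ≤
      ∑ x ∈ A, Q x * (P x / Q x) ^ α := by
    refine Finset.sum_le_sum fun x hx => ?_
    have h1 := hP x (hsub hx)
    have h2 := hQ x (hsub hx)
    have h3 := mul_le_mul_of_nonneg_left (aux_tangent hα hapos (r := P x / Q x) (by positivity)) h2.le
    have e : Q x * (α * a ^ (α - 1) * (P x / Q x) - (α - 1) * a ^ α) =
      α * a ^ (α - 1) * P x - (α - 1) * a ^ α * Q x := by field_simp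
    linarith
  rw [Finset.sum_sub_distrib, ← Finset.mul_sum, ← Finset.mul_sum, ← hp, ← hq] at hT
  have haα : a ^ (α - 1) = a ^ α * (1 - (p - q)) := by
    rw [rpow_sub_one hapos.ne', div_eq_iff hapos.ne', mul_assoc, mul_comm _ a, hat, mul_one]
  have hbound : a ^ (α - 1) ≤ S := by
    have h1 : 1 ≤ α * (p - q) := by
      rw [div_lt_iff₀ hαpos] at h; linarith
    have h2 : 0 ≤ a ^ α * ((α * (p - q) - 1) * (1 - p)) := by
      apply mul_nonneg (by positivity)
      apply mul_nonneg <;> linarith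
    rw [haα] at hT ⊢
    nlinarith
  have h1 := Real.rpow_le_rpow_of_nonpos (by positivity) hbound (z := 1 / (1 - α))
    (by apply one_div_nonpos.2; linarith)
  rw [← Real.rpow_mul hapos.le, show (α - 1) * (1 / (1 - α)) = -1 by
    have : 1 - α ≠ 0 := by linarith
    field_simp; ring, rpow_neg_one, ha, inv_inv] at h1
  linarith

theorem aux_rev {Y : Type*} [Fintype Y] (α : ℝ) (hα : 1 < α) (P Q : Y → ℝ)
    (hP : ∀ y, 0 < P y) (hQ : ∀ y, 0 < Q y) (hP1 : ∑ y, P y = 1) (hQ1 : ∑ y, Q y = 1)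
    (u v : ℝ) (hv0 : 0 < v) (hv1 : v < 1) (hu1 : 1 < u)
    (hu : ∀ y, P y / Q y ≤ u) (hv : ∀ y, v ≤ P y / Q y) :
    0 ≤ (u ^ α - 1) / (u - 1) - (1 - v ^ α) / (1 - v) ∧
    (∑ y, Q y * (P y / Q y) ^ α) - 1 ≤
      ((u ^ α - 1) / (u - 1) - (1 - v ^ α) / (1 - v)) * ((1 / 2) * ∑ y, |P y - Q y|) := by
  have hc := convexOn_rpow hα.le
  have hs : ∀ x y : ℝ, 0 ≤ x → x ≠ 1 → y ≠ 1 → x ≤ y →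
      (x ^ α - 1) / (x - 1) ≤ (y ^ α - 1) / (y - 1) := by
    intro x y hx hx1 hy1 hxy
    have := hc.secant_mono (a := 1) (x := x) (y := y) (by simp) hx (le_trans hx hxy) hx1 hy1 hxy
    simpa using this
  have hve : (1 - v ^ α) / (1 - v) = (v ^ α - 1) / (v - 1) := by
    rw [← neg_div_neg_eq]; simp
  rw [hve]
  set U := (u ^ α - 1) / (u - 1)
  set V := (v ^ α - 1) / (v - 1)
  refine ⟨sub_nonneg.2 (hs v u hv0.le hv1.ne hu1.ne' (by linarith)), ?_⟩
  have key : ∑ y, (Q y * (P y / Q y) ^ α - Q y) ≤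
      ∑ y, ((U - V) * (1/2) * |P y - Q y| + (U + V) * (1/2) * (P y - Q y)) := by
    refine Finset.sum_le_sum fun y _ => ?_
    have h1 := hP y
    have h2 := hQ y
    have hr0 : 0 < P y / Q y := by positivity
    have hPr : P y = Q y * (P y / Q y) := by field_simp
    have hu := hu y
    have hv := hv y
    generalize P y / Q y = r at *
    rw [hPr]
    rcases lt_trichotomy r 1 with h | h | h
    · have := hs v r hv0.le hv1.ne h.ne hv
      rw [le_div_iff_of_neg (by linarith)] at this
      rw [abs_of_nonpos (by nlinarith)]
      nlinarith
    · subst h; simp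
    · have := hs r u hr0.le h.ne' hu1.ne' hu
      rw [div_le_iff₀ (by linarith)] at this
      rw [abs_of_nonneg (by nlinarith)]
      nlinarith
  rw [Finset.sum_sub_distrib, Finset.sum_add_distrib, ← Finset.mul_sum, ← Finset.mul_sum,
    Finset.sum_sub_distrib, hP1, hQ1] at key
  linarith


/-- SDPI-style cross-channel bound, Corollary 1: for a channel `K`,
mutually absolutely continuous inputs `P, Q`, strictly positive distinct outputs
`K∘P ≠ K∘Q`, a TV-contraction factor `η`, and the cross-channel extremal ratios
`u = max_y (K∘P)(y)/(K∘Q)(y)`, `v = min_y (K∘P)(y)/(K∘Q)(y)`, one has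
`D_{f_α}(K∘P ‖ K∘Q) ≤ η · R_α(u,v) · g_α^{-1}(D_{f_α}(P‖Q))`. -/
theorem stmt_14 {X Y : Type*} [Fintype X] [Fintype Y] (α : ℝ) (hα : 1 < α)
    (K : X → Y → ℝ) (hK0 : ∀ x y, 0 ≤ K x y) (hK1 : ∀ x, ∑ y, K x y = 1)
    (P Q : X → ℝ) (hP0 : ∀ x, 0 ≤ P x) (hQ0 : ∀ x, 0 ≤ Q x)
    (hP1 : ∑ x, P x = 1) (hQ1 : ∑ x, Q x = 1)
    (hsupp : ∀ x, 0 < P x ↔ 0 < Q x)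
    (KP KQ : Y → ℝ)
    (hKP : KP = fun y => ∑ x, K x y * P x) (hKQ : KQ = fun y => ∑ x, K x y * Q x)
    (hKP0 : ∀ y, 0 < KP y) (hKQ0 : ∀ y, 0 < KQ y) (hne : KP ≠ KQ)
    (η : ℝ) (hη0 : 0 ≤ η)
    (hηTV : (1 / 2) * (∑ y, |KP y - KQ y|) ≤ η * ((1 / 2) * ∑ x, |P x - Q x|))
    (u v : ℝ)
    (hu : ∀ y, KP y / KQ y ≤ u) (hu' : ∃ y, KP y / KQ y = u)
    (hv : ∀ y, v ≤ KP y / KQ y) (hv' : ∃ y, KP y / KQ y = v)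
    (s : ℝ)
    (hs : s = (∑ x ∈ Finset.univ.filter (fun x => 0 < Q x), Q x * (P x / Q x) ^ α) - 1) :
    (∑ y, KQ y * (KP y / KQ y) ^ α) - 1 ≤
      η * ((u ^ α - 1) / (u - 1) - (1 - v ^ α) / (1 - v)) *
        (if α < 2 ∧ s < 2 - 2 / α then
            Real.sqrt (Real.log (s + 1) / (2 * (α - 1)))
          else if 2 ≤ α ∧ s < (1 + 4 / α ^ 2) ^ (α - 1) - 1 then
            (1 / 2) * Real.sqrt ((s + 1) ^ (1 / (α - 1)) - 1)
          else max (1 - (s + 1) ^ (1 / (1 - α))) (1 / α)) := by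
  have hPF : ∀ x ∈ Finset.univ.filter (fun x => 0 < Q x), 0 < P x :=
    fun x hx => (hsupp x).2 (Finset.mem_filter.1 hx).2
  have hQF : ∀ x ∈ Finset.univ.filter (fun x => 0 < Q x), 0 < Q x :=
    fun x hx => (Finset.mem_filter.1 hx).2
  have hQz : ∀ x, ¬ 0 < Q x → Q x = 0 := fun x h => le_antisymm (not_lt.1 h) (hQ0 x)
  have hPz : ∀ x, ¬ 0 < Q x → P x = 0 := fun x h =>
    le_antisymm (not_lt.1 fun h' => h ((hsupp x).1 h')) (hP0 x)
  have hPF1 : ∑ x ∈ Finset.univ.filter (fun x => 0 < Q x), P x = 1 := by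
    rw [← hP1]
    exact Finset.sum_filter_of_ne fun x _ h => by_contra fun h' => h (hPz x h')
  have hQF1 : ∑ x ∈ Finset.univ.filter (fun x => 0 < Q x), Q x = 1 := by
    rw [← hQ1]
    exact Finset.sum_filter_of_ne fun x _ h => by_contra fun h' => h (hQz x h')
  have hTVF : ∑ x ∈ Finset.univ.filter (fun x => 0 < Q x), |P x - Q x| = ∑ x, |P x - Q x| :=
    Finset.sum_filter_of_ne fun x _ h => by_contra fun h' => h (by simp [hPz x h', hQz x h'])
  have hsum : ∀ R : X → ℝ, ∑ x, R x = 1 → ∑ y, ∑ x, K x y * R x = 1 := by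
    intro R hR
    rw [Finset.sum_comm, ← hR]
    refine Finset.sum_congr rfl fun x _ => ?_
    rw [← Finset.sum_mul, hK1, one_mul]
  have hKP1 : ∑ y, KP y = 1 := by rw [hKP]; exact hsum P hP1
  have hKQ1 : ∑ y, KQ y = 1 := by rw [hKQ]; exact hsum Q hQ1
  have hv0 : 0 < v := by
    obtain ⟨y, hy⟩ := hv'
    rw [← hy]; exact div_pos (hKP0 y) (hKQ0 y)
  have hu1 : 1 < u := by
    by_contra hcon
    apply hne
    have hle : ∀ y ∈ Finset.univ, KP y ≤ KQ y := fun y _ => by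
      have := (hu y).trans (not_lt.1 hcon)
      rwa [div_le_one (hKQ0 y)] at this
    funext y
    exact (Finset.sum_eq_sum_iff_of_le hle).1 (hKP1.trans hKQ1.symm) y (Finset.mem_univ y)
  have hv1 : v < 1 := by
    by_contra hcon
    apply hne
    have hle : ∀ y ∈ Finset.univ, KQ y ≤ KP y := fun y _ => by
      have := (not_lt.1 hcon).trans (hv y)
      rwa [one_le_div (hKQ0 y)] at this
    funext y
    exact ((Finset.sum_eq_sum_iff_of_le hle).1 (hKQ1.trans hKP1.symm) y (Finset.mem_univ y)).symm
  obtain ⟨hR, hrev⟩ := aux_rev α hα KP KQ hKP0 hKQ0 hKP1 hKQ1 u v hv0 hv1 hu1 hu hv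
  refine hrev.trans ((mul_le_mul_of_nonneg_left hηTV hR).trans ?_)
  rw [mul_comm η (_ - _), mul_assoc (_ - _) η]
  refine mul_le_mul_of_nonneg_left (mul_le_mul_of_nonneg_left ?_ hη0) hR
  have hs1 : s + 1 = ∑ x ∈ Finset.univ.filter (fun x => 0 < Q x), Q x * (P x / Q x) ^ α := by
    rw [hs]; ring
  rw [← hTVF, hs1]
  split_ifs with h1 h2
  · exact aux_reg1 _ P Q α hα hPF hQF hPF1 hQF1
  · exact aux_reg2 _ P Q α h2.1 hPF hQF hPF1 hQF1
  · exact aux_reg3 _ P Q α hα hPF hQF hPF1 hQF1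
end
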